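/- Let X ⊆ ℝ^n, c ∈ ℝ^n, and let 𝒫 be a partition of S. Assume Λ is nonempty and for every x ∈ X and every s ∈ S there exists y ≥ 0 with W y = h^s − T^s x (relatively complete recourse on X). Suppose x̄ ∈ X minimizes x ↦ c·x + Σ_{P∈𝒫} p^P Q(x, h^P, T^P) over X, and that for every s ∈ S there exist y^s ≥ 0 with W y^s = h^s − T^s x̄ and λ^s ∈ Λ with q·y^s = (h^s − T^s x̄)·λ^s, such that for every P ∈ 𝒫 the family (λ^s)_{s∈P} satisfies conditions (9a)–(9b) at x̄. Then x̄ minimizes x ↦ c·x + Σ_{s∈S} p^s Q(x, h^s, T^s) over X. -/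

import Mathlib

open Finset Matrix BigOperators

/-- Second-stage value `Q(x, h, T) = inf {q·y : y ≥ 0, W y = h − T x}`. -/
noncomputable def secondStageValue {n m p : ℕ}
    (W : Matrix (Fin p) (Fin m) ℝ) (q : Fin m → ℝ)
    (x : Fin n → ℝ) (h : Fin p → ℝ) (T : Matrix (Fin p) (Fin n) ℝ) : ℝ :=
  sInf {v | ∃ y : Fin m → ℝ, 0 ≤ y ∧ W.mulVec y = h - T.mulVec x ∧ v = q ⬝ᵥ y}

/-- Weak duality. -/
theorem gapm_weak {m p : ℕ} (W : Matrix (Fin p) (Fin m) ℝ) (q : Fin m → ℝ)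
    (y : Fin m → ℝ) (hy : 0 ≤ y) (b lam : Fin p → ℝ) (hb : W.mulVec y = b)
    (hl : W.transpose.mulVec lam ≤ q) : b ⬝ᵥ lam ≤ q ⬝ᵥ y := by
  rw [← hb, dotProduct_comm, dotProduct_mulVec, ← mulVec_transpose]
  exact dotProduct_le_dotProduct_of_nonneg_right hl hy

/-- The value set is bounded below. -/
theorem gapm_bdd {n m p : ℕ} (W : Matrix (Fin p) (Fin m) ℝ) (q : Fin m → ℝ)
    (x : Fin n → ℝ) (h : Fin p → ℝ) (T : Matrix (Fin p) (Fin n) ℝ)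
    (hΛ : ∃ lam : Fin p → ℝ, W.transpose.mulVec lam ≤ q) :
    BddBelow {v | ∃ y : Fin m → ℝ, 0 ≤ y ∧ W.mulVec y = h - T.mulVec x ∧ v = q ⬝ᵥ y} := by
  obtain ⟨l, hl⟩ := hΛ
  refine ⟨(h - T.mulVec x) ⬝ᵥ l, ?_⟩
  rintro v ⟨y, hy, he, rfl⟩
  exact gapm_weak W q y hy _ l he hl

theorem gapm_le {n m p : ℕ} (W : Matrix (Fin p) (Fin m) ℝ) (q : Fin m → ℝ)
    (x : Fin n → ℝ) (h : Fin p → ℝ) (T : Matrix (Fin p) (Fin n) ℝ)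
    (hΛ : ∃ lam : Fin p → ℝ, W.transpose.mulVec lam ≤ q)
    (y : Fin m → ℝ) (hy : 0 ≤ y) (he : W.mulVec y = h - T.mulVec x) :
    secondStageValue W q x h T ≤ q ⬝ᵥ y :=
  csInf_le (gapm_bdd W q x h T hΛ) ⟨y, hy, he, rfl⟩

/-- Averages of feasible recourse decisions are feasible for averaged data. -/
theorem gapm_avg {n m p : ℕ} (W : Matrix (Fin p) (Fin m) ℝ) {S : Type*}
    (pr : S → ℝ) (h : S → Fin p → ℝ) (T : S → Matrix (Fin p) (Fin n) ℝ)
    (P : Finset S) (x : Fin n → ℝ) (a : ℝ) (y : S → Fin m → ℝ)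
    (he : ∀ s, W.mulVec (y s) = h s - (T s).mulVec x) :
    W.mulVec (a • ∑ s ∈ P, pr s • y s) =
      (a • ∑ s ∈ P, pr s • h s) - (a • ∑ s ∈ P, pr s • T s).mulVec x := by
  rw [mulVec_smul, mulVec_sum, smul_mulVec, sum_mulVec, ← smul_sub, ← Finset.sum_sub_distrib]
  congr 1
  refine Finset.sum_congr rfl fun s _ => ?_
  rw [mulVec_smul, he, smul_mulVec, smul_sub]

/-- **GAPM optimality.** Under relatively complete recourse on `X` and a
nonempty dual-feasible set `Λ`, if `x̄` minimizes the aggregated problem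
`c·x + ∑_{P∈parts} p^P Q(x, h^P, T^P)` over `X`, and at `x̄` each scenario
subproblem has a primal optimal `yˢ` and an LP-dual optimal `λˢ ∈ Λ`
satisfying conditions (9a)–(9b) on every cell `P ∈ parts`, then `x̄` minimizes
the true objective `c·x + ∑_{s∈S} pˢ Q(x, hˢ, Tˢ)` over `X`. -/
theorem gapm_partition_optimal
    {n m p : ℕ} (W : Matrix (Fin p) (Fin m) ℝ) (q : Fin m → ℝ)
    {S : Type*} [Fintype S] [DecidableEq S]
    (pr : S → ℝ) (hpr : ∀ s, 0 < pr s)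
    (h : S → Fin p → ℝ) (T : S → Matrix (Fin p) (Fin n) ℝ)
    (X : Set (Fin n → ℝ)) (c : Fin n → ℝ)
    (parts : Finset (Finset S))
    (hcellne : ∀ P ∈ parts, P.Nonempty)
    (hdisj : ∀ P ∈ parts, ∀ Q ∈ parts, P ≠ Q → Disjoint P Q)
    (hcover : parts.biUnion id = Finset.univ)
    (hΛ : ∃ lam : Fin p → ℝ, W.transpose.mulVec lam ≤ q)
    (hrcr : ∀ x ∈ X, ∀ s : S, ∃ y : Fin m → ℝ, 0 ≤ y ∧
      W.mulVec y = h s - (T s).mulVec x)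
    (xbar : Fin n → ℝ) (hxbar : xbar ∈ X)
    (hmin : ∀ x ∈ X,
      c ⬝ᵥ xbar + ∑ P ∈ parts, (∑ s ∈ P, pr s) *
        secondStageValue W q xbar ((∑ s ∈ P, pr s)⁻¹ • ∑ s ∈ P, pr s • h s)
          ((∑ s ∈ P, pr s)⁻¹ • ∑ s ∈ P, pr s • T s)
      ≤ c ⬝ᵥ x + ∑ P ∈ parts, (∑ s ∈ P, pr s) *
        secondStageValue W q x ((∑ s ∈ P, pr s)⁻¹ • ∑ s ∈ P, pr s • h s)
          ((∑ s ∈ P, pr s)⁻¹ • ∑ s ∈ P, pr s • T s))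
    (y : S → Fin m → ℝ) (hy0 : ∀ s, 0 ≤ y s)
    (hyfeas : ∀ s, W.mulVec (y s) = h s - (T s).mulVec xbar)
    (lam : S → Fin p → ℝ) (hlamfeas : ∀ s, W.transpose.mulVec (lam s) ≤ q)
    (hstrong : ∀ s, q ⬝ᵥ y s = (h s - (T s).mulVec xbar) ⬝ᵥ lam s)
    (hcond : ∀ P ∈ parts,
      (∑ s ∈ P, pr s) * ∑ s ∈ P, pr s * (h s ⬝ᵥ lam s)
        = (∑ s ∈ P, pr s • h s) ⬝ᵥ (∑ s ∈ P, pr s • lam s) ∧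
      (∑ s ∈ P, pr s) * ∑ s ∈ P, pr s * (((T s).mulVec xbar) ⬝ᵥ lam s)
        = (∑ s ∈ P, pr s • (T s).mulVec xbar) ⬝ᵥ (∑ s ∈ P, pr s • lam s)) :
    ∀ x ∈ X,
      c ⬝ᵥ xbar + ∑ s, pr s * secondStageValue W q xbar (h s) (T s)
        ≤ c ⬝ᵥ x + ∑ s, pr s * secondStageValue W q x (h s) (T s) := by
  have hPpos : ∀ P ∈ parts, 0 < ∑ s ∈ P, pr s := fun P hP =>
    Finset.sum_pos (fun s _ => hpr s) (hcellne P hP)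
  have hsplit : ∀ f : S → ℝ, ∑ s, f s = ∑ P ∈ parts, ∑ s ∈ P, f s := by
    intro f
    rw [← hcover, Finset.sum_biUnion]
    · rfl
    · intro P hP Q hQ hne
      exact hdisj P hP Q hQ hne
  have havg0 : ∀ P ∈ parts, ∀ z : S → Fin m → ℝ, (∀ s, 0 ≤ z s) →
      0 ≤ (∑ s ∈ P, pr s)⁻¹ • ∑ s ∈ P, pr s • z s := by
    intro P hP z hz
    exact smul_nonneg (inv_nonneg.2 (hPpos P hP).le)
      (Finset.sum_nonneg fun s _ => smul_nonneg (hpr s).le (hz s))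
  have upper : ∀ x ∈ X, ∀ P ∈ parts, (∑ s ∈ P, pr s) *
        secondStageValue W q x ((∑ s ∈ P, pr s)⁻¹ • ∑ s ∈ P, pr s • h s)
          ((∑ s ∈ P, pr s)⁻¹ • ∑ s ∈ P, pr s • T s)
      ≤ ∑ s ∈ P, pr s * secondStageValue W q x (h s) (T s) := by
    intro x hx P hP
    have hp := hPpos P hP
    rw [← le_div_iff₀' hp]
    refine le_of_forall_pos_le_add fun ε hε => ?_
    have hex : ∀ s, ∃ z : Fin m → ℝ, 0 ≤ z ∧ W.mulVec z = h s - (T s).mulVec x ∧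
        q ⬝ᵥ z < secondStageValue W q x (h s) (T s) + ε := by
      intro s
      obtain ⟨z0, h0, h1⟩ := hrcr x hx s
      have hne : {v | ∃ y : Fin m → ℝ, 0 ≤ y ∧ W.mulVec y = h s - (T s).mulVec x ∧
          v = q ⬝ᵥ y}.Nonempty := ⟨_, z0, h0, h1, rfl⟩
      obtain ⟨v, ⟨z, hz0, hz1, rfl⟩, hlt⟩ := Real.lt_sInf_add_pos hne hε
      exact ⟨z, hz0, hz1, hlt⟩
    choose z hz0 hz1 hz2 using hex
    refine (gapm_le W q x _ _ hΛ _ (havg0 P hP z hz0) (gapm_avg W pr h T P x _ z hz1)).trans ?_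
    rw [dotProduct_smul, dotProduct_sum, smul_eq_mul, inv_mul_eq_div, div_add' _ _ _ hp.ne']
    refine div_le_div_of_nonneg_right ?_ hp.le
    rw [Finset.mul_sum, ← Finset.sum_add_distrib]
    refine Finset.sum_le_sum fun s _ => ?_
    rw [dotProduct_smul, smul_eq_mul]
    nlinarith [hz2 s, hpr s]
  have lower : ∀ P ∈ parts, ∑ s ∈ P, pr s * secondStageValue W q xbar (h s) (T s) ≤
      (∑ s ∈ P, pr s) *
        secondStageValue W q xbar ((∑ s ∈ P, pr s)⁻¹ • ∑ s ∈ P, pr s • h s)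
          ((∑ s ∈ P, pr s)⁻¹ • ∑ s ∈ P, pr s • T s) := by
    intro P hP
    have hp := hPpos P hP
    obtain ⟨c1, c2⟩ := hcond P hP
    have hA : ∑ s ∈ P, pr s * secondStageValue W q xbar (h s) (T s) ≤
        ∑ s ∈ P, pr s * (h s ⬝ᵥ lam s) - ∑ s ∈ P, pr s * (((T s).mulVec xbar) ⬝ᵥ lam s) := by
      rw [← Finset.sum_sub_distrib]
      refine Finset.sum_le_sum fun s _ => ?_
      rw [← mul_sub, ← sub_dotProduct, ← hstrong]
      exact mul_le_mul_of_nonneg_left (gapm_le W q xbar _ _ hΛ _ (hy0 s) (hyfeas s)) (hpr s).le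
    refine hA.trans ?_
    rw [← div_le_iff₀' hp]
    refine le_csInf ⟨_, _, havg0 P hP y hy0, gapm_avg W pr h T P xbar _ y hyfeas, rfl⟩ ?_
    rintro v ⟨z, hz0, hz1, rfl⟩
    have hl : W.transpose.mulVec ((∑ s ∈ P, pr s)⁻¹ • ∑ s ∈ P, pr s • lam s) ≤ q := by
      rw [mulVec_smul, mulVec_sum]
      have h1 : ∑ s ∈ P, W.transpose.mulVec (pr s • lam s) ≤ ∑ s ∈ P, pr s • q := by
        refine Finset.sum_le_sum fun s _ => ?_
        rw [mulVec_smul]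
        exact smul_le_smul_of_nonneg_left (hlamfeas s) (hpr s).le
      refine (smul_le_smul_of_nonneg_left h1 (inv_nonneg.2 hp.le)).trans ?_
      rw [← Finset.sum_smul, smul_smul, inv_mul_cancel₀ hp.ne', one_smul]
    refine le_trans (le_of_eq ?_) (gapm_weak W q z hz0 _ _ hz1 hl)
    have hT : (∑ s ∈ P, pr s • T s).mulVec xbar = ∑ s ∈ P, pr s • (T s).mulVec xbar := by
      rw [sum_mulVec]
      exact Finset.sum_congr rfl fun s _ => smul_mulVec _ _ _
    rw [smul_mulVec, hT, ← smul_sub, smul_dotProduct, dotProduct_smul, sub_dotProduct, ← c1, ← c2,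
      smul_eq_mul, smul_eq_mul]
    field_simp
  intro x hx
  rw [hsplit, hsplit]
  have h1 := Finset.sum_le_sum lower
  have h2 := Finset.sum_le_sum (upper x hx)
  have h3 := hmin x hx
  linarith
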